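/- Let P = ⟨H,M,T⟩ be an abduction problem whose theory T is a set of clauses over a set V of n propositional variables, let Πₙ denote the set of all clauses over V, and let C = { c_γ : γ ∈ Πₙ }, D = { d_γ : γ ∈ Πₙ }, E = { e_γ : γ ∈ Πₙ } be sets of fresh propositional variables in one-to-one correspondence with Πₙ. For H₁ ⊆ H define H₂ = H₁ ∪ { c_γ : γ ∈ T } ∪ { d_γ : γ ∈ Πₙ \ T }, and define P' = ⟨H',M',T'⟩ by H' = H ∪ C ∪ D, M' = M ∪ E, and T' = { c_γ → e_γ : γ ∈ Πₙ } ∪ { d_γ → e_γ : γ ∈ Πₙ } ∪ { c_γ → γ : γ ∈ Πₙ }. Then for every h ∈ H₁: H₂ \ {h} ∈ SOL(P') if and only if H₁ \ {h} ∈ SOL(P). -/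

import Mathlib

/-- Propositional formulas over a set `V` of variables. -/
inductive PropForm (V : Type) : Type where
  | fls  : PropForm V
  | var  : V → PropForm V
  | neg  : PropForm V → PropForm V
  | conj : PropForm V → PropForm V → PropForm V
  | disj : PropForm V → PropForm V → PropForm V
  | imp  : PropForm V → PropForm V → PropForm V
  deriving DecidableEq

namespace PropForm

/-- Truth of a formula under a valuation. -/
def eval {V : Type} (v : V → Prop) : PropForm V → Prop
  | fls => False
  | var x => v x
  | neg φ => ¬ eval v φ
  | conj φ ψ => eval v φ ∧ eval v ψ
  | disj φ ψ => eval v φ ∨ eval v ψ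
  | imp φ ψ => eval v φ → eval v ψ

/-- The set of variables occurring in a formula. -/
def vars {V : Type} : PropForm V → Set V
  | fls => ∅
  | var x => {x}
  | neg φ => vars φ
  | conj φ ψ => vars φ ∪ vars ψ
  | disj φ ψ => vars φ ∪ vars ψ
  | imp φ ψ => vars φ ∪ vars ψ

end PropForm

/-- An abduction problem `⟨H, M, T⟩`: hypotheses, manifestations, theory. -/
structure AbdProblem (V : Type) [DecidableEq V] : Type where
  H : Finset V
  M : Finset V
  T : Finset (PropForm V)

variable {V : Type} [DecidableEq V]

/-- `v` is a model of the hypotheses `A` together with the theory `T`. -/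
def models (v : V → Prop) (A : Finset V) (T : Finset (PropForm V)) : Prop :=
  (∀ x ∈ A, v x) ∧ (∀ φ ∈ T, φ.eval v)

/-- `A` is a solution of `P`: `A ⊆ H`, `A ∪ T` is satisfiable, `A ∪ T ⊨ m` for `m ∈ M`. -/
def isSol (P : AbdProblem V) (A : Finset V) : Prop :=
  A ⊆ P.H ∧ (∃ v, models v A P.T) ∧ ∀ v, models v A P.T → ∀ m ∈ P.M, v m

/-- The set of solutions of `P`. -/
def SOL (P : AbdProblem V) : Set (Finset V) := {A | isSol P A}

/-- The solutions of `P` minimal under set inclusion. -/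
def SOLsub (P : AbdProblem V) : Set (Finset V) :=
  {A | A ∈ SOL P ∧ ∀ B ∈ SOL P, B ⊆ A → B = A}

/-- The solutions of `P` of minimum cardinality. -/
def SOLcard (P : AbdProblem V) : Set (Finset V) :=
  {A | A ∈ SOL P ∧ ∀ B ∈ SOL P, A.card ≤ B.card}

/-- `x` is fresh for `P`: it occurs neither in `H`, nor in `M`, nor in any formula of `T`. -/
def freshFor (P : AbdProblem V) (x : V) : Prop :=
  x ∉ P.H ∧ x ∉ P.M ∧ ∀ φ ∈ P.T, x ∉ φ.vars

/-- A clause, given as a pair (positive variables, negated variables),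
    rendered as a disjunction of literals. -/
noncomputable def clauseForm (γ : Finset V × Finset V) : PropForm V :=
  (γ.1.toList.map PropForm.var
    ++ γ.2.toList.map (fun x => PropForm.neg (PropForm.var x))).foldr
    PropForm.disj PropForm.fls

/-- `Πₙ`: the set of all clauses over the variable set `W`. -/
def allClauses (W : Finset V) : Finset (Finset V × Finset V) :=
  W.powerset ×ˢ W.powerset

theorem PropForm.eval_congr {U : Type} {v w : U → Prop} (φ : PropForm U)
    (h : ∀ x ∈ φ.vars, (v x ↔ w x)) : φ.eval v ↔ φ.eval w := by
  induction φ <;> simp_all [PropForm.eval, PropForm.vars]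

theorem compile_removal_correspondence (H M W : Finset V) (n : ℕ) (hW : W.card = n)
    (Tc : Finset (Finset V × Finset V)) (hTc : Tc ⊆ allClauses W)
    (c d e : Finset V × Finset V → V)
    (hcinj : Set.InjOn c ↑(allClauses W)) (hdinj : Set.InjOn d ↑(allClauses W))
    (heinj : Set.InjOn e ↑(allClauses W))
    (hcfresh : ∀ γ ∈ allClauses W, freshFor ⟨H, M, Tc.image clauseForm⟩ (c γ))
    (hdfresh : ∀ γ ∈ allClauses W, freshFor ⟨H, M, Tc.image clauseForm⟩ (d γ))
    (hefresh : ∀ γ ∈ allClauses W, freshFor ⟨H, M, Tc.image clauseForm⟩ (e γ))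
    (hcd : ∀ γ ∈ allClauses W, ∀ δ ∈ allClauses W, c γ ≠ d δ)
    (hce : ∀ γ ∈ allClauses W, ∀ δ ∈ allClauses W, c γ ≠ e δ)
    (hde : ∀ γ ∈ allClauses W, ∀ δ ∈ allClauses W, d γ ≠ e δ)
    (H₁ : Finset V) (hH₁ : H₁ ⊆ H) :
    ∀ x ∈ H₁,
      ((H₁ ∪ Tc.image c ∪ (allClauses W \ Tc).image d) \ {x} ∈
        SOL (⟨H ∪ (allClauses W).image c ∪ (allClauses W).image d,
        M ∪ (allClauses W).image e,
        (allClauses W).image (fun γ => PropForm.imp (PropForm.var (c γ)) (PropForm.var (e γ)))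
          ∪ (allClauses W).image (fun γ => PropForm.imp (PropForm.var (d γ)) (PropForm.var (e γ)))
          ∪ (allClauses W).image (fun γ => PropForm.imp (PropForm.var (c γ)) (clauseForm γ))⟩ :
        AbdProblem V) ↔
      H₁ \ {x} ∈ SOL ⟨H, M, Tc.image clauseForm⟩) := by
  intro x hx
  have hxH := hH₁ hx
  have hcx : ∀ γ ∈ allClauses W, c γ ≠ x := fun γ hγ h => (hcfresh γ hγ).1 (h ▸ hxH)
  have hdx : ∀ γ ∈ allClauses W, d γ ≠ x := fun γ hγ h => (hdfresh γ hγ).1 (h ▸ hxH)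
  set H₂ := (H₁ ∪ Tc.image c ∪ (allClauses W \ Tc).image d) \ {x} with hH₂
  set T' := (allClauses W).image
      (fun γ => PropForm.imp (PropForm.var (c γ)) (PropForm.var (e γ)))
    ∪ (allClauses W).image (fun γ => PropForm.imp (PropForm.var (d γ)) (PropForm.var (e γ)))
    ∪ (allClauses W).image (fun γ => PropForm.imp (PropForm.var (c γ)) (clauseForm γ)) with hT'
  have models_iff : ∀ v, models v H₂ T' ↔
      ((∀ y ∈ H₁ \ {x}, v y) ∧ (∀ γ ∈ Tc, v (c γ)) ∧ ∀ γ ∈ allClauses W \ Tc, v (d γ)) ∧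
      ∀ γ ∈ allClauses W, (v (c γ) → v (e γ)) ∧ (v (d γ) → v (e γ)) ∧
        (v (c γ) → (clauseForm γ).eval v) := by
    intro v
    refine and_congr ⟨fun h => ⟨?_, ?_, ?_⟩, ?_⟩ ⟨fun h γ hγ => ⟨?_, ?_, ?_⟩, ?_⟩
    · intro y hy
      exact h y (by grind)
    · intro γ hγ
      exact h _ (by grind)
    · intro γ hγ
      exact h _ (by grind)
    · rintro ⟨h₁, h₂, h₃⟩ y hy
      grind
    · exact h (.imp (.var (c γ)) (.var (e γ))) (by grind)
    · exact h (.imp (.var (d γ)) (.var (e γ))) (by grind)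
    · exact h (.imp (.var (c γ)) (clauseForm γ)) (by grind)
    · intro h φ hφ
      simp only [hT', Finset.mem_union, Finset.mem_image] at hφ
      rcases hφ with (⟨γ, hγ, rfl⟩ | ⟨γ, hγ, rfl⟩) | ⟨γ, hγ, rfl⟩
      · exact (h γ hγ).1
      · exact (h γ hγ).2.1
      · exact (h γ hγ).2.2
  have models_restrict : ∀ v, models v H₂ T' → models v (H₁ \ {x}) (Tc.image clauseForm) := by
    intro v hv
    obtain ⟨⟨h₁, h₂, -⟩, h⟩ := (models_iff v).1 hv
    refine ⟨h₁, fun φ hφ => ?_⟩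
    obtain ⟨γ, hγ, rfl⟩ := Finset.mem_image.1 hφ
    exact (h γ (hTc hγ)).2.2 (h₂ γ hγ)
  have models_extend : ∀ v, models v (H₁ \ {x}) (Tc.image clauseForm) →
      ∃ w, models w H₂ T' ∧ ∀ m ∈ M, w m → v m := by
    intro v hv
    let w : V → Prop := fun y => (y ∈ Tc.image c ∨ y ∈ (allClauses W).image d ∨
      y ∈ (allClauses W).image e) ∨ (v y ∧ y ∉ (allClauses W).image c)
    have hwv : ∀ y, ¬ (y ∈ (allClauses W).image c ∨ y ∈ (allClauses W).image d ∨
        y ∈ (allClauses W).image e) → (w y ↔ v y) := by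
      intro y hy
      have := Finset.image_subset_image (f := c) hTc
      grind
    have hwc : ∀ γ ∈ allClauses W, w (c γ) → γ ∈ Tc := by
      intro γ hγ h
      rcases h with (h | h | h) | h
      · obtain ⟨δ, hδ, hδγ⟩ := Finset.mem_image.1 h
        exact hcinj (hTc hδ) hγ hδγ ▸ hδ
      · obtain ⟨δ, hδ, hδγ⟩ := Finset.mem_image.1 h
        exact absurd hδγ.symm (hcd γ hγ δ hδ)
      · obtain ⟨δ, hδ, hδγ⟩ := Finset.mem_image.1 h
        exact absurd hδγ.symm (hce γ hγ δ hδ)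
      · exact absurd (Finset.mem_image_of_mem c hγ) h.2
    have hwe : ∀ γ ∈ allClauses W, w (e γ) := fun γ hγ =>
      Or.inl (Or.inr (Or.inr (Finset.mem_image_of_mem e hγ)))
    refine ⟨w, (models_iff w).2 ⟨⟨?_, ?_, ?_⟩, ?_⟩, ?_⟩
    · intro y hy
      have hyH : y ∈ H := hH₁ (Finset.mem_sdiff.1 hy).1
      refine (hwv y ?_).2 (hv.1 y hy)
      simp only [Finset.mem_image]
      rintro (⟨γ, hγ, rfl⟩ | ⟨γ, hγ, rfl⟩ | ⟨γ, hγ, rfl⟩)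
      exacts [(hcfresh γ hγ).1 hyH, (hdfresh γ hγ).1 hyH, (hefresh γ hγ).1 hyH]
    · exact fun γ hγ => Or.inl (Or.inl (Finset.mem_image_of_mem c hγ))
    · exact fun γ hγ => Or.inl (Or.inr (Or.inl
        (Finset.mem_image_of_mem d (Finset.mem_sdiff.1 hγ).1)))
    · refine fun γ hγ => ⟨fun _ => hwe γ hγ, fun _ => hwe γ hγ, fun h => ?_⟩
      have hγT : clauseForm γ ∈ Tc.image clauseForm :=
        Finset.mem_image_of_mem _ (hwc γ hγ h)
      refine (PropForm.eval_congr _ fun y hy => hwv y ?_).2 (hv.2 _ hγT)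
      simp only [Finset.mem_image]
      rintro (⟨δ, hδ, rfl⟩ | ⟨δ, hδ, rfl⟩ | ⟨δ, hδ, rfl⟩)
      exacts [(hcfresh δ hδ).2.2 _ hγT hy, (hdfresh δ hδ).2.2 _ hγT hy,
        (hefresh δ hδ).2.2 _ hγT hy]
    · intro m hm
      refine (hwv m ?_).1
      simp only [Finset.mem_image]
      rintro (⟨γ, hγ, rfl⟩ | ⟨γ, hγ, rfl⟩ | ⟨γ, hγ, rfl⟩)
      exacts [(hcfresh γ hγ).2.1 hm, (hdfresh γ hγ).2.1 hm, (hefresh γ hγ).2.1 hm]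
  constructor
  · rintro ⟨-, ⟨v, hv⟩, hM⟩
    refine ⟨Finset.sdiff_subset.trans hH₁, ⟨v, models_restrict v hv⟩, fun u hu m hm => ?_⟩
    obtain ⟨w, hw, hwu⟩ := models_extend u hu
    exact hwu m hm (hM w hw m (Finset.mem_union_left _ hm))
  · rintro ⟨-, ⟨v, hv⟩, hM⟩
    obtain ⟨w, hw, -⟩ := models_extend v hv
    refine ⟨?_, ⟨w, hw⟩, fun u hu m hm => ?_⟩
    · exact Finset.sdiff_subset.trans (Finset.union_subset_union
        (Finset.union_subset_union hH₁ (Finset.image_subset_image hTc))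
        (Finset.image_subset_image Finset.sdiff_subset))
    · rcases Finset.mem_union.1 hm with hm | hm
      · exact hM u (models_restrict u hu) m hm
      · obtain ⟨γ, hγ, rfl⟩ := Finset.mem_image.1 hm
        obtain ⟨⟨-, h₂, h₃⟩, h⟩ := (models_iff u).1 hu
        by_cases hγT : γ ∈ Tc
        · exact (h γ hγ).1 (h₂ γ hγT)
        · exact (h γ hγ).2.1 (h₃ γ (Finset.mem_sdiff.2 ⟨hγ, hγT⟩))
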